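/- arXiv:0902.2646 — 4 statements merged into one kernel-verified Lean document; each statement's English description precedes it below -/
import Mathlib

section
/- For all integers n and k with 1 ≤ k ≤ n, the following variant of the Chu–Vandermonde summation holds: Σ_{ℓ=1}^{k} C(k,ℓ)·(ℓ/n)·C(3n, n−ℓ) = (k/n)·C(3n+k−1, n−1); moreover (k/n)·C(3n+k−1, n−1) = (k/(3n+k))·C(3n+k, n). -/
/-- Chu–Vandermonde, summed over a range that need only cover the support of `j.choose`. -/
lemma sum_range_choose_mul_choose_sub (N : ℕ) {j m : ℕ} (hjm : j ≤ m) :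
    ∑ i ∈ Finset.range (j + 1), j.choose i * N.choose (m - i) = (N + j).choose m := by
  rw [Nat.add_comm N j, Nat.add_choose_eq, Finset.Nat.sum_antidiagonal_eq_sum_range_succ_mk]
  refine Finset.sum_subset (Finset.range_subset_range.2 (Nat.succ_le_succ hjm)) fun i _ hi => ?_
  rw [Nat.choose_eq_zero_of_lt (by simpa using hi), zero_mul]

/-- a variant of the Chu–Vandermonde summation:
for `1 ≤ k ≤ n`,
`∑_{ℓ=1}^{k} C(k,ℓ) (ℓ/n) C(3n, n-ℓ) = (k/n) C(3n+k-1, n-1)`, and moreover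
`(k/n) C(3n+k-1, n-1) = (k/(3n+k)) C(3n+k, n)`. -/
theorem stmt_3 (n k : ℕ) (hk : 1 ≤ k) (hkn : k ≤ n) :
    (∑ ℓ ∈ Finset.Icc 1 k,
        (k.choose ℓ : ℚ) * (ℓ : ℚ) / n * ((3 * n).choose (n - ℓ) : ℚ)) =
      (k : ℚ) / n * ((3 * n + k - 1).choose (n - 1) : ℚ) ∧
    (k : ℚ) / n * ((3 * n + k - 1).choose (n - 1) : ℚ) =
      (k : ℚ) / (3 * n + k) * ((3 * n + k).choose n : ℚ) := by
  obtain ⟨j, rfl⟩ := Nat.exists_eq_add_of_le' hk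
  obtain ⟨m, rfl⟩ := Nat.exists_eq_add_of_le' (hk.trans hkn)
  have hsub : 3 * (m + 1) + (j + 1) - 1 = 3 * (m + 1) + j := by lia
  rw [hsub, Nat.add_sub_cancel]
  constructor
  · rw [← sum_range_choose_mul_choose_sub _ (Nat.le_of_succ_le_succ hkn), Nat.cast_sum,
      Finset.mul_sum, ← Finset.Ico_add_one_right_eq_Icc, Finset.sum_Ico_eq_sum_range]
    refine Finset.sum_congr (by simp) fun i _ => ?_
    have h : ((j : ℚ) + 1) * j.choose i = (j + 1).choose (i + 1) * (i + 1) :=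
      mod_cast Nat.add_one_mul_choose_eq j i
    rw [Nat.add_comm 1 i, Nat.add_sub_add_right]
    push_cast
    rw [← h]
    ring
  · have h : (3 * ((m : ℚ) + 1) + j + 1) * (3 * (m + 1) + j).choose m =
        (3 * (m + 1) + (j + 1)).choose (m + 1) * (m + 1) :=
      mod_cast Nat.add_one_mul_choose_eq (3 * (m + 1) + j) m
    push_cast
    field_simp
    linear_combination h
end

section
/- For every real number z with 0 < z < 4/27, the series Σ_{n≥1} (1/(2n+1))·C(3n,n)·zⁿ converges and its sum T̃(z) equals (2/√(3z))·sin( (1/3)·arctan( √( 27z/(4−27z) ) ) ) − 1. -/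
/-- A power series with polynomially bounded coefficients converges absolutely on `(-1, 1)`. -/
lemma summable_mul_pow_of_abs_le {c : ℕ → ℝ} {C : ℝ} {m : ℕ}
    (hc : ∀ n : ℕ, |c n| ≤ C * ((n : ℝ) + 1) ^ m) {x : ℝ} (hx : |x| < 1) :
    Summable fun n => |c n * x ^ n| := by
  have hgeom : Summable fun n : ℕ => C * (((n : ℝ) + 1) ^ m * |x| ^ n) := by
    refine Summable.mul_left C ?_
    by_cases h0 : |x| = 0
    · refine summable_of_ne_finset_zero (s := {0}) fun n hn => ?_
      simp only [Finset.mem_singleton] at hn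
      simp [h0, hn]
    · have hs := (summable_nat_add_iff 1).2
        (summable_pow_mul_geometric_of_norm_lt_one m (r := |x|) (by simpa using hx))
      refine (hs.mul_right |x|⁻¹).congr fun n => ?_
      push_cast
      field_simp
      ring
  refine hgeom.of_nonneg_of_le (fun _ => abs_nonneg _) fun n => ?_
  rw [abs_mul, abs_pow, ← mul_assoc]
  exact mul_le_mul_of_nonneg_right (hc n) (by positivity)

/-- Polynomial growth of coefficients is preserved by formal differentiation. -/
lemma abs_succ_mul_le {c : ℕ → ℝ} {C : ℝ} {m : ℕ}
    (hc : ∀ n : ℕ, |c n| ≤ C * ((n : ℝ) + 1) ^ m) (n : ℕ) :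
    |((n : ℝ) + 1) * c (n + 1)| ≤ C * 2 ^ m * ((n : ℝ) + 1) ^ (m + 1) := by
  have hC : 0 ≤ C := by simpa using (abs_nonneg _).trans (hc 0)
  have h := hc (n + 1)
  rw [abs_mul, abs_of_nonneg (by positivity : (0 : ℝ) ≤ n + 1)]
  calc ((n : ℝ) + 1) * |c (n + 1)|
      ≤ (n + 1) * (C * ((↑(n + 1) : ℝ) + 1) ^ m) := by gcongr
    _ ≤ (n + 1) * (C * (2 * ((n : ℝ) + 1)) ^ m) := by
        gcongr
        push_cast
        linarith [(Nat.cast_nonneg n : (0 : ℝ) ≤ n)]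
    _ = C * 2 ^ m * ((n : ℝ) + 1) ^ (m + 1) := by rw [mul_pow]; ring

/-- Termwise differentiation of a power series with polynomially bounded coefficients. -/
lemma hasDerivAt_tsum_mul_pow {c : ℕ → ℝ} {C : ℝ} {m : ℕ}
    (hc : ∀ n : ℕ, |c n| ≤ C * ((n : ℝ) + 1) ^ m) {x : ℝ} (hx : |x| < 1) :
    HasDerivAt (fun y => ∑' n, c n * y ^ n)
      (∑' n : ℕ, ((n : ℝ) + 1) * c (n + 1) * x ^ n) x := by
  obtain ⟨r, hxr, hr1⟩ := exists_between hx
  have hr0 : 0 ≤ r := (abs_nonneg x).trans hxr.le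
  have hbound : Summable fun n : ℕ => |c n * (n * r ^ (n - 1))| := by
    refine (summable_nat_add_iff 1).1 ?_
    refine (summable_mul_pow_of_abs_le (abs_succ_mul_le hc)
      (x := r) (by rwa [abs_of_nonneg hr0])).congr fun n => ?_
    congr 1
    push_cast
    ring
  have hd := hasDerivAt_tsum_of_isPreconnected (g := fun n y => c n * y ^ n)
    (g' := fun n y => c n * (n * y ^ (n - 1))) (t := Metric.ball 0 r) (y₀ := 0) (y := x)
    hbound Metric.isOpen_ball (convex_ball (0 : ℝ) r).isPreconnected
    (fun n y _ => (hasDerivAt_pow n y).const_mul (c n))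
    (fun n y hy => by
      have hy' : |y| ≤ r := by simpa using (mem_ball_zero_iff.1 hy).le
      rw [Real.norm_eq_abs, abs_mul, abs_mul, abs_mul, abs_mul, abs_pow, abs_pow,
        abs_of_nonneg hr0]
      gcongr)
    (Metric.mem_ball_self ((abs_nonneg x).trans_lt hxr))
    (summable_mul_pow_of_abs_le hc (by simp)).of_abs
    (by simpa using hxr)
  refine hd.congr_deriv ?_
  have hs : Summable fun n : ℕ => c n * (n * x ^ (n - 1)) := by
    refine ((summable_nat_add_iff 1).1 ?_)
    refine (summable_mul_pow_of_abs_le (abs_succ_mul_le hc) hx).of_abs.congr fun n => ?_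
    push_cast
    ring
  rw [hs.tsum_eq_zero_add]
  simp only [Nat.cast_zero, zero_mul, mul_zero, zero_add, Nat.cast_add, Nat.cast_one,
    Nat.add_sub_cancel]
  exact tsum_congr fun n => by ring

/-- The Taylor coefficients at `0` of `x ↦ sin (arcsin x / 3)`. -/
noncomputable def sinThirdArcsinCoeff : ℕ → ℝ
  | 0 => 0
  | 1 => 1 / 3
  | k + 2 => ((k : ℝ) ^ 2 - 1 / 9) / ((k + 1) * (k + 2)) * sinThirdArcsinCoeff k

lemma sinThirdArcsinCoeff_rec (k : ℕ) :
    ((k : ℝ) + 1) * ((k + 2) * sinThirdArcsinCoeff (k + 2)) =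
      ((k : ℝ) ^ 2 - 1 / 9) * sinThirdArcsinCoeff k := by
  rw [sinThirdArcsinCoeff]
  field_simp

lemma abs_sinThirdArcsinCoeff_le : ∀ k, |sinThirdArcsinCoeff k| ≤ 1
  | 0 => by simp [sinThirdArcsinCoeff]
  | 1 => by norm_num [sinThirdArcsinCoeff, abs_of_pos]
  | k + 2 => by
    have hk : (0 : ℝ) ≤ k := Nat.cast_nonneg k
    rw [sinThirdArcsinCoeff, abs_mul]
    refine mul_le_one₀ ?_ (abs_nonneg _) (abs_sinThirdArcsinCoeff_le k)
    rw [abs_div, abs_of_pos (by positivity : (0 : ℝ) < (k + 1) * (k + 2)),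
      div_le_one (by positivity), abs_le]
    constructor <;> nlinarith

lemma sinThirdArcsinCoeff_even : ∀ n, sinThirdArcsinCoeff (2 * n) = 0
  | 0 => rfl
  | n + 1 => by
    rw [show 2 * (n + 1) = 2 * n + 2 by ring, sinThirdArcsinCoeff, sinThirdArcsinCoeff_even n,
      mul_zero]

lemma choose_three_mul_succ (n : ℕ) :
    (2 * (n : ℝ) + 2) * (2 * n + 1) * (3 * (n + 1)).choose (n + 1) =
      3 * (3 * n + 2) * (3 * n + 1) * (3 * n).choose n := by
  have h1 := Nat.add_choose_mul_factorial_mul_factorial (2 * n) n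
  have h2 := Nat.add_choose_mul_factorial_mul_factorial (2 * n + 2) (n + 1)
  rw [show 2 * n + n = 3 * n by ring] at h1
  rw [show 2 * n + 2 + (n + 1) = 3 * n + 3 by ring] at h2
  simp only [Nat.factorial_succ] at h2
  rw [← h1] at h2
  rw [show 3 * (n + 1) = 3 * n + 3 by ring]
  have h3 : (((3 * n + 3).choose (n + 1) * ((2 * n + 1 + 1) * ((2 * n + 1) * (2 * n).factorial)) *
      ((n + 1) * n.factorial) : ℕ) : ℝ) = _ := congrArg _ h2
  push_cast at h3
  have ha : ((2 * n).factorial : ℝ) ≠ 0 := by positivity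
  have hb : (n.factorial : ℝ) ≠ 0 := by positivity
  have hn : (n : ℝ) + 1 ≠ 0 := by positivity
  refine mul_right_cancel₀ (mul_ne_zero (mul_ne_zero ha hb) hn) ?_
  linear_combination h3

lemma sinThirdArcsinCoeff_odd (n : ℕ) :
    sinThirdArcsinCoeff (2 * n + 1) =
      (3 * n).choose n / (2 * n + 1) * (4 / 27) ^ n / 3 := by
  induction n with
  | zero => simp [sinThirdArcsinCoeff]
  | succ n ih =>
    rw [show 2 * (n + 1) + 1 = 2 * n + 1 + 2 by ring, sinThirdArcsinCoeff, ih]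
    have h := choose_three_mul_succ n
    have h' : ((3 * (n + 1)).choose (n + 1) : ℝ) =
        3 * (3 * n + 2) * (3 * n + 1) * (3 * n).choose n / ((2 * n + 2) * (2 * n + 1)) := by
      rw [eq_div_iff (by positivity)]
      linear_combination h
    rw [h', pow_succ]
    push_cast
    field_simp
    ring

/-- The differential equation `(1 - x²) F'' - x F' + F / 9 = 0` for the power series `F`
with coefficients `sinThirdArcsinCoeff`. -/
lemma tsum_sinThirdArcsinCoeff_ode {x : ℝ} (hx : |x| < 1) :
    (1 - x ^ 2) * (∑' n : ℕ, ((n : ℝ) + 1) *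
        ((((n + 1 : ℕ) : ℝ) + 1) * sinThirdArcsinCoeff (n + 1 + 1)) * x ^ n) -
      x * (∑' n : ℕ, ((n : ℝ) + 1) * sinThirdArcsinCoeff (n + 1) * x ^ n) +
      (∑' n : ℕ, sinThirdArcsinCoeff n * x ^ n) / 9 = 0 := by
  have hb : ∀ n : ℕ, |sinThirdArcsinCoeff n| ≤ 1 * ((n : ℝ) + 1) ^ 0 := by
    simpa using abs_sinThirdArcsinCoeff_le
  have s0 := (summable_mul_pow_of_abs_le hb hx).of_abs.hasSum
  have s1 := (summable_mul_pow_of_abs_le (abs_succ_mul_le hb) hx).of_abs.hasSum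
  have s2 := (summable_mul_pow_of_abs_le (abs_succ_mul_le (abs_succ_mul_le hb)) hx).of_abs.hasSum
  have t1 : HasSum (fun n : ℕ => (n : ℝ) * sinThirdArcsinCoeff n * x ^ n)
      (x * ∑' n : ℕ, ((n : ℝ) + 1) * sinThirdArcsinCoeff (n + 1) * x ^ n) := by
    rw [← hasSum_nat_add_iff' 1, Finset.sum_range_one, Nat.cast_zero, zero_mul, zero_mul, sub_zero]
    refine (s1.mul_left x).congr_fun fun n => ?_
    push_cast
    ring
  have t2 : HasSum (fun n : ℕ => (n : ℝ) * (n - 1) * sinThirdArcsinCoeff n * x ^ n)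
      (x ^ 2 * ∑' n : ℕ, ((n : ℝ) + 1) *
        ((((n + 1 : ℕ) : ℝ) + 1) * sinThirdArcsinCoeff (n + 1 + 1)) * x ^ n) := by
    rw [← hasSum_nat_add_iff' 2, Finset.sum_range_succ, Finset.sum_range_one]
    simp only [Nat.cast_zero, Nat.cast_one, sub_self, zero_mul, mul_zero, add_zero, sub_zero]
    refine (s2.mul_left (x ^ 2)).congr_fun fun n => ?_
    push_cast
    ring
  have key := (((s2.sub t2).sub t1).add (s0.div_const 9))
  have hz := key.unique (hasSum_zero.congr_fun fun n => ?_)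
  · linear_combination hz
  · have h := sinThirdArcsinCoeff_rec n
    push_cast
    linear_combination x ^ n * h

/-- The power series expansion of `sin (θ / 3)` in terms of `sin θ`. -/
lemma hasSum_sin_third {θ : ℝ} (hθ : θ ∈ Set.Ioo (-(Real.pi / 2)) (Real.pi / 2)) :
    HasSum (fun n => sinThirdArcsinCoeff n * Real.sin θ ^ n) (Real.sin (θ / 3)) := by
  have hb : ∀ n : ℕ, |sinThirdArcsinCoeff n| ≤ 1 * ((n : ℝ) + 1) ^ 0 := by
    simpa using abs_sinThirdArcsinCoeff_le
  have hsin : ∀ t ∈ Set.Ioo (-(Real.pi / 2)) (Real.pi / 2), |Real.sin t| < 1 := by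
    intro t ht
    rw [← sq_lt_one_iff_abs_lt_one]
    nlinarith [Real.sin_sq_add_cos_sq t, Real.cos_pos_of_mem_Ioo ht]
  set F : ℝ → ℝ := fun x => ∑' n, sinThirdArcsinCoeff n * x ^ n with hF
  set F' : ℝ → ℝ := fun x => ∑' n : ℕ, ((n : ℝ) + 1) * sinThirdArcsinCoeff (n + 1) * x ^ n with hF'
  set G : ℝ → ℝ := fun t => F (Real.sin t)
  set H : ℝ → ℝ := fun t => F' (Real.sin t) * Real.cos t
  have hG : ∀ t ∈ Set.Ioo (-(Real.pi / 2)) (Real.pi / 2), HasDerivAt G (H t) t := fun t ht =>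
    (hasDerivAt_tsum_mul_pow hb (hsin t ht)).comp t (Real.hasDerivAt_sin t)
  have hH : ∀ t ∈ Set.Ioo (-(Real.pi / 2)) (Real.pi / 2), HasDerivAt H (-(G t / 9)) t := by
    intro t ht
    have h := ((hasDerivAt_tsum_mul_pow (abs_succ_mul_le hb) (hsin t ht)).comp t
      (Real.hasDerivAt_sin t)).mul (Real.hasDerivAt_cos t)
    refine h.congr_deriv ?_
    have ode := tsum_sinThirdArcsinCoeff_ode (hsin t ht)
    simp only [G, hF, Function.comp_apply]
    rw [← Real.cos_sq'] at ode
    linear_combination ode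
  have hs : ∀ t : ℝ, HasDerivAt (fun t => Real.sin (t / 3)) (Real.cos (t / 3) * (1 / 3)) t :=
    fun t => ((hasDerivAt_id t).div_const 3).sin
  have hc : ∀ t : ℝ, HasDerivAt (fun t => Real.cos (t / 3)) (-Real.sin (t / 3) * (1 / 3)) t :=
    fun t => ((hasDerivAt_id t).div_const 3).cos
  have h0 : (0 : ℝ) ∈ Set.Ioo (-(Real.pi / 2)) (Real.pi / 2) := by
    constructor <;> linarith [Real.pi_pos]
  have const : ∀ f : ℝ → ℝ, (∀ t ∈ Set.Ioo (-(Real.pi / 2)) (Real.pi / 2), HasDerivAt f 0 t) →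
      f θ = f 0 := fun f hf =>
    isOpen_Ioo.is_const_of_deriv_eq_zero isPreconnected_Ioo
      (fun t ht => (hf t ht).differentiableAt.differentiableWithinAt)
      (fun t ht => (hf t ht).deriv) hθ h0
  have e1 := const (fun t => G t * Real.sin (t / 3) + 3 * H t * Real.cos (t / 3)) fun t ht =>
    (((hG t ht).mul (hs t)).add (((hH t ht).const_mul 3).mul (hc t))).congr_deriv (by ring)
  have e2 := const (fun t => G t * Real.cos (t / 3) - 3 * H t * Real.sin (t / 3)) fun t ht =>
    (((hG t ht).mul (hc t)).sub (((hH t ht).const_mul 3).mul (hs t))).congr_deriv (by ring)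
  have hG0 : G 0 = 0 := by
    simp only [G, hF, Real.sin_zero]
    rw [tsum_eq_single 0 (fun n hn => by simp [hn])]
    simp [sinThirdArcsinCoeff]
  have hH0 : H 0 = 1 / 3 := by
    simp only [H, hF', Real.sin_zero]
    rw [tsum_eq_single 0 (fun n hn => by simp [hn])]
    simp [sinThirdArcsinCoeff]
  simp only [hG0, hH0, zero_div, Real.sin_zero, Real.cos_zero] at e1 e2
  have hGθ : G θ = Real.sin (θ / 3) := by
    linear_combination Real.sin (θ / 3) * e1 + Real.cos (θ / 3) * e2 -
      G θ * Real.sin_sq_add_cos_sq (θ / 3)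
  rw [← hGθ]
  exact (summable_mul_pow_of_abs_le hb (hsin θ hθ)).of_abs.hasSum

/-- for every real `z` with `0 < z < 4/27` the series
`∑_{n ≥ 1} C(3n, n) z^n / (2n+1)` converges, with sum
`(2/√(3z)) sin((1/3) arctan(√(27z/(4-27z)))) - 1`. -/
theorem stmt_7 (z : ℝ) (hz0 : 0 < z) (hz1 : z < 4 / 27) :
    HasSum
      (fun n : ℕ => ((3 * (n + 1)).choose (n + 1) : ℝ) * z ^ (n + 1) / (2 * (n + 1) + 1))
      (2 / Real.sqrt (3 * z) *
          Real.sin ((1 / 3) * Real.arctan (Real.sqrt (27 * z / (4 - 27 * z)))) - 1) := by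
  have hden : 0 < 4 - 27 * z := by linarith
  set t := Real.sqrt (27 * z / (4 - 27 * z)) with ht
  have ht2 : t ^ 2 = 27 * z / (4 - 27 * z) := Real.sq_sqrt (by positivity)
  set θ := Real.arctan t
  have hx0 : 0 < Real.sin θ := Real.sin_arctan_pos.2 (Real.sqrt_pos.2 (by positivity))
  have hx2 : Real.sin θ ^ 2 = 27 * z / 4 := by
    rw [Real.sin_arctan, div_pow, Real.sq_sqrt (by positivity : 0 ≤ 1 + t ^ 2), ht2]
    field_simp
    ring
  have hsqrt : Real.sqrt (3 * z) = 2 * Real.sin θ / 3 := by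
    rw [Real.sqrt_eq_iff_mul_self_eq (by positivity) (by positivity)]
    linear_combination -(4 / 9) * hx2
  have h := hasSum_sin_third (Real.arctan_mem_Ioo t)
  have hinj : Function.Injective fun n : ℕ => 2 * n + 1 := fun a b hab => by
    simpa using hab
  rw [← hinj.hasSum_iff] at h
  · have h3 := h.mul_left (3 / Real.sin θ)
    rw [← hasSum_nat_add_iff' 1] at h3
    have hval : 2 / Real.sqrt (3 * z) * Real.sin (1 / 3 * θ) - 1 =
        3 / Real.sin θ * Real.sin (θ / 3) - ∑ i ∈ Finset.range 1, 3 / Real.sin θ *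
          ((fun n => sinThirdArcsinCoeff n * Real.sin θ ^ n) ∘ fun n => 2 * n + 1) i := by
      rw [hsqrt, show 1 / 3 * θ = θ / 3 by ring]
      simp only [Finset.sum_range_one, Function.comp_apply, mul_zero, zero_add, pow_one,
        sinThirdArcsinCoeff]
      field_simp
    rw [hval]
    refine h3.congr_fun fun n => ?_
    have hz : z = 4 / 27 * Real.sin θ ^ 2 := by rw [hx2]; ring
    change _ = 3 / Real.sin θ * (sinThirdArcsinCoeff (2 * (n + 1) + 1) *
      Real.sin θ ^ (2 * (n + 1) + 1))
    rw [sinThirdArcsinCoeff_odd, show z ^ (n + 1) = (4 / 27) ^ (n + 1) *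
      Real.sin θ ^ (2 * (n + 1)) by rw [pow_mul, ← mul_pow, ← hz], pow_succ _ (2 * (n + 1))]
    push_cast
    field_simp
  · intro k hk
    rcases Nat.even_or_odd' k with ⟨n, rfl | rfl⟩
    · rw [sinThirdArcsinCoeff_even, zero_mul]
    · exact absurd ⟨n, rfl⟩ hk
end

section
/- The number T_{n,s,m₁,m₂,m₃} of ternary trees of size n ≥ 1 in which the path from the root to the external node numbered s contains exactly m₁ left edges, m₂ center edges and m₃ right edges is given as follows. Write s = 2s₁ + s₂ with 0 ≤ s₁ ≤ n and s₂ ∈ {0,1}. (i) If 0 ≤ m₃ ≤ s₁, m₂ = s₂ + 2μ₂ for some integer 0 ≤ μ₂ ≤ s₁ − m₃, and (m₁,m₂) ≠ (0,0) and (m₃,m₂) ≠ (0,0), then T_{n,s,m₁,m₂,m₃} = (2m₃+m₂)(2m₁+m₂)·( (m₁+m₂+m₃)!/(m₁!m₂!m₃!) )·C(3s₁+s₂−m₃−μ₂, s₁−m₃−μ₂)·C(3n−m₁−2m₂−3s₁+3μ₂, n−m₁−m₂−s₁+μ₂) / ( (3s₁+s₂−m₃−μ₂)(3n−m₁−2m₂−3s₁+3μ₂)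 ). (ii) If (m₂,m₃) = (0,0), then T_{n,s,m₁,0,0} = (2m₁/(3n−m₁))·C(3n−m₁, 2n) when s = 0 and 0 ≤ m₁ ≤ n. (iii) If (m₁,m₂) = (0,0), then T_{n,s,0,0,m₃} = (2m₃/(3n−m₃))·C(3n−m₃, 2n) when s = 2n and 0 ≤ m₃ ≤ n. (iv) In all other cases T_{n,s,m₁,m₂,m₃} = 0. -/
/-- A ternary tree is either an external node (leaf) or an internal node with an
ordered triple of ternary subtrees (left, center, right). -/
inductive TernaryTree : Type
  | leaf : TernaryTree
  | node (l c r : TernaryTree) : TernaryTree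

namespace TernaryTree

/-- The size of a ternary tree is its number of internal nodes; a tree of size `n`
has `2n + 1` external nodes. -/
def size : TernaryTree → ℕ
  | leaf => 0
  | node l c r => l.size + c.size + r.size + 1

/-- `t.leafPath s = (m₁, m₂, m₃)` where the path from the root of `t` to the external
node numbered `s` (external nodes being numbered `0, …, 2·size t` from left to right by
inorder traversal: left subtree, center subtree, right subtree) contains `m₁` left
edges (type 1), `m₂` center edges (type 2) and `m₃` right edges (type 3). -/
def leafPath : TernaryTree → ℕ → ℕ × ℕ × ℕ
  | leaf, _ => (0, 0, 0)
  | node l c r, s =>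
      if s ≤ 2 * l.size then
        let p := l.leafPath s
        (p.1 + 1, p.2.1, p.2.2)
      else if s ≤ 2 * l.size + 2 * c.size + 1 then
        let p := c.leafPath (s - (2 * l.size + 1))
        (p.1, p.2.1 + 1, p.2.2)
      else
        let p := r.leafPath (s - (2 * l.size + 2 * c.size + 2))
        (p.1, p.2.1, p.2.2 + 1)

end TernaryTree

/-- `pathCount n s m₁ m₂ m₃` is the number `T_{n,s,m₁,m₂,m₃}` of ternary trees of size
`n` in which the path from the root to the external node numbered `s` contains exactly
`m₁` left edges, `m₂` center edges and `m₃` right edges. -/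
noncomputable def pathCount (n s m₁ m₂ m₃ : ℕ) : ℕ :=
  Nat.card {t : TernaryTree // t.size = n ∧ t.leafPath s = (m₁, m₂, m₃)}

/-- Binomial coefficient `C(a, b)` for integer arguments, with the convention that
`C(a, b) = 0` when `b < 0` or `b > a`. -/
noncomputable def ichoose (a b : ℤ) : ℚ :=
  if 0 ≤ b ∧ b ≤ a then (a.toNat.choose b.toNat : ℚ) else 0

namespace TernaryTree

/-- Ordered forests of `k` ternary trees. -/
abbrev Forest : ℕ → Type
  | 0 => Unit
  | k + 1 => TernaryTree × Forest k

/-- The total number of external nodes of a forest. -/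
def leafCount : (k : ℕ) → Forest k → ℕ
  | 0, _ => 0
  | k + 1, f => 2 * f.1.size + 1 + leafCount k f.2

/-- The forests of `k` trees with `p` external nodes in total. -/
def forests (k p : ℕ) : Set (Forest k) := {f | leafCount k f = p}

theorem exists_leafCount_eq (k : ℕ) (f : Forest k) : ∃ N, leafCount k f = 2 * N + k := by
  induction k with
  | zero => exact ⟨0, rfl⟩
  | succ k ih =>
    obtain ⟨N, hN⟩ := ih f.2
    exact ⟨f.1.size + N, by simp only [leafCount]; omega⟩

theorem encard_forests_eq_zero {k p : ℕ} (h : ∀ N, p ≠ 2 * N + k) :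
    (forests k p).encard = 0 := by
  rw [Set.encard_eq_zero, Set.eq_empty_iff_forall_notMem]
  intro f hf
  obtain ⟨N, hN⟩ := exists_leafCount_eq k f
  exact h N (hf.symm.trans hN)

theorem encard_forests_zero_zero : (forests 0 0).encard = 1 :=
  Set.encard_eq_one.2 ⟨(), by ext; simp [forests, leafCount]⟩

theorem encard_forests_succ (k p : ℕ) :
    (forests (k + 1) (p + 1)).encard = (forests k p).encard + (forests (k + 3) (p + 1)).encard := by
  let f : Forest k → Forest (k + 1) := fun x => (leaf, x)
  let g : Forest (k + 3) → Forest (k + 1) := fun x => (node x.1 x.2.1 x.2.2.1, x.2.2.2)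
  have hf : f.Injective := fun x y h => (Prod.ext_iff.1 h).2
  have hg : g.Injective := by
    rintro ⟨a, b, c, x⟩ ⟨a', b', c', x'⟩ h
    simp only [g, Prod.mk.injEq, node.injEq] at h
    obtain ⟨⟨rfl, rfl, rfl⟩, rfl⟩ := h
    rfl
  have h : forests (k + 1) (p + 1) = f '' forests k p ∪ g '' forests (k + 3) (p + 1) := by
    ext ⟨t, x⟩
    constructor
    · intro h
      cases t with
      | leaf =>
        refine Or.inl ⟨x, ?_, rfl⟩
        simp only [forests, leafCount, size, Set.mem_ofPred_eq] at h ⊢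
        omega
      | node a b c =>
        refine Or.inr ⟨(a, b, c, x), ?_, rfl⟩
        simp only [forests, leafCount, size, Set.mem_ofPred_eq] at h ⊢
        omega
    · rintro (⟨y, hy, h⟩ | ⟨⟨a, b, c, y⟩, hy, h⟩) <;>
      · rw [← h]
        simp only [f, g, forests, leafCount, size, Set.mem_ofPred_eq] at hy ⊢
        omega
  rw [h, Set.encard_union_eq, hf.encard_image, hg.encard_image]
  rw [Set.disjoint_left]
  rintro _ ⟨x, -, rfl⟩ ⟨y, -, h⟩
  simp [f, g] at h

/-- The number of forests of `k` trees with `N` internal nodes is `k / (3N + k) * C(3N + k, N)`. -/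
theorem exists_encard_forests (N k : ℕ) : ∃ c : ℕ, (forests k (2 * N + k)).encard = c ∧
    c * (N.factorial * (2 * N + k).factorial) * (3 * N + k) = k * (3 * N + k).factorial := by
  induction N generalizing k with
  | zero =>
    refine ⟨1, ?_, by simp [mul_comm]⟩
    induction k with
    | zero => simpa using encard_forests_zero_zero
    | succ k ih =>
      rw [← add_assoc, encard_forests_succ, ih, encard_forests_eq_zero fun N => by omega]
      simp
  | succ N ih =>
    induction k with
    | zero =>
      refine ⟨0, ?_, by simp⟩
      rw [Nat.cast_zero, Set.encard_eq_zero, Set.eq_empty_iff_forall_notMem]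
      intro f hf
      simp only [forests, leafCount, Set.mem_ofPred_eq] at hf
      omega
    | succ k ihk =>
      obtain ⟨c, hc, hc'⟩ := ihk
      obtain ⟨d, hd, hd'⟩ := ih (k + 3)
      refine ⟨c + d, ?_, ?_⟩
      · rw [← add_assoc, encard_forests_succ, hc,
          show 2 * (N + 1) + k + 1 = 2 * N + (k + 3) by ring, hd, Nat.cast_add]
      · rw [show 3 * (N + 1) + k = 3 * N + k + 2 + 1 by ring,
          show 2 * (N + 1) + k = 2 * N + k + 2 by ring] at hc'
        rw [show 3 * N + (k + 3) = 3 * N + k + 2 + 1 by ring,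
          show 2 * N + (k + 3) = 2 * N + k + 2 + 1 by ring] at hd'
        rw [show 3 * (N + 1) + (k + 1) = 3 * N + k + 2 + 1 + 1 by ring,
          show 2 * (N + 1) + (k + 1) = 2 * N + k + 2 + 1 by ring]
        simp only [Nat.factorial_succ (3 * N + k + 2 + 1), Nat.factorial_succ (3 * N + k + 2),
          Nat.factorial_succ (2 * N + k + 2), Nat.factorial_succ N] at hc' hd' ⊢
        generalize (3 * N + k + 2).factorial = X at *
        generalize (2 * N + k + 2).factorial = Y at *
        generalize N.factorial = Z at *
        have hc : c * ((N + 1) * Z * Y) = k * X :=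
          Nat.eq_of_mul_eq_mul_right (Nat.succ_pos (3 * N + k + 2)) (by linarith)
        have hd : d * (Z * ((2 * N + k + 2 + 1) * Y)) = (k + 3) * X :=
          Nat.eq_of_mul_eq_mul_right (Nat.succ_pos (3 * N + k + 2)) (by linarith)
        linear_combination (2 * N + k + 3) * (3 * N + k + 4) * hc + (N + 1) * (3 * N + k + 4) * hd

/-- Trees with a marked external node, accompanied by a forest of `i` trees on the left and a forest
of `j` trees on the right, such that there are `p` external nodes to the left and `q` to the right
of the marked one, and such that the path to the marked node satisfies `P`. -/
def pointed (i j p q : ℕ) (P : ℕ × ℕ × ℕ → Prop) : Set (Forest i × (TernaryTree × ℕ) × Forest j) :=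
  {x | x.2.1.2 ≤ 2 * x.2.1.1.size ∧ leafCount i x.1 + x.2.1.2 = p ∧
    leafCount j x.2.2 + 2 * x.2.1.1.size = x.2.1.2 + q ∧ P (x.2.1.1.leafPath x.2.1.2)}

theorem encard_pointed_zero (i j p q : ℕ) :
    (pointed i j p q (· = (0, 0, 0))).encard = (forests i p).encard * (forests j q).encard := by
  let f : Forest i × Forest j → Forest i × (TernaryTree × ℕ) × Forest j :=
    fun x => (x.1, (leaf, 0), x.2)
  have hf : f.Injective := by
    rintro ⟨a, b⟩ ⟨c, d⟩ h
    simpa [f] using h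
  rw [← Set.encard_prod, ← hf.encard_image]
  congr 1
  ext ⟨A, ⟨t, s⟩, B⟩
  constructor
  · rintro ⟨h1, h2, h3, h4⟩
    cases t with
    | leaf =>
      obtain rfl : s = 0 := by simpa [size] using h1
      exact ⟨(A, B), ⟨h2, by simpa [forests, size] using h3⟩, rfl⟩
    | node l c r =>
      simp only [leafPath] at h4
      split_ifs at h4 <;> simp at h4
  · rintro ⟨⟨A', B'⟩, ⟨h1, h2⟩, h⟩
    simp only [f, Prod.mk.injEq] at h
    obtain ⟨rfl, ⟨rfl, rfl⟩, rfl⟩ := h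
    simp only [forests, Set.mem_ofPred_eq] at h1 h2
    simp [pointed, leafPath, size, h1, h2]

theorem encard_pointed (i j p q : ℕ) (P : ℕ × ℕ × ℕ → Prop) (hP : ¬ P (0, 0, 0)) :
    (pointed i j p q P).encard =
      (pointed i (j + 2) p q fun m => P (m.1 + 1, m.2.1, m.2.2)).encard +
      (pointed (i + 1) (j + 1) p q fun m => P (m.1, m.2.1 + 1, m.2.2)).encard +
      (pointed (i + 2) j p q fun m => P (m.1, m.2.1, m.2.2 + 1)).encard := by
  let f : Forest i × (TernaryTree × ℕ) × Forest (j + 2) →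
      Forest i × (TernaryTree × ℕ) × Forest j :=
    fun x => (x.1, (node x.2.1.1 x.2.2.1 x.2.2.2.1, x.2.1.2), x.2.2.2.2)
  let g : Forest (i + 1) × (TernaryTree × ℕ) × Forest (j + 1) →
      Forest i × (TernaryTree × ℕ) × Forest j :=
    fun x => (x.1.2, (node x.1.1 x.2.1.1 x.2.2.1, x.2.1.2 + (2 * x.1.1.size + 1)), x.2.2.2)
  let h : Forest (i + 2) × (TernaryTree × ℕ) × Forest j →
      Forest i × (TernaryTree × ℕ) × Forest j :=
    fun x => (x.1.2.2, (node x.1.1 x.1.2.1 x.2.1.1,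
      x.2.1.2 + (2 * x.1.1.size + 2 * x.1.2.1.size + 2)), x.2.2)
  have hf : f.Injective := by
    rintro ⟨A, ⟨t, s⟩, c, r, B⟩ ⟨A', ⟨t', s'⟩, c', r', B'⟩ e
    simp only [f, Prod.mk.injEq, node.injEq] at e
    obtain ⟨rfl, ⟨⟨rfl, rfl, rfl⟩, rfl⟩, rfl⟩ := e
    rfl
  have hg : g.Injective := by
    rintro ⟨⟨l, A⟩, ⟨t, s⟩, r, B⟩ ⟨⟨l', A'⟩, ⟨t', s'⟩, r', B'⟩ e
    simp only [g, Prod.mk.injEq, node.injEq] at e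
    obtain ⟨rfl, ⟨⟨rfl, rfl, rfl⟩, e⟩, rfl⟩ := e
    obtain rfl := Nat.add_right_cancel e
    rfl
  have hh : h.Injective := by
    rintro ⟨⟨l, c, A⟩, ⟨t, s⟩, B⟩ ⟨⟨l', c', A'⟩, ⟨t', s'⟩, B'⟩ e
    simp only [h, Prod.mk.injEq, node.injEq] at e
    obtain ⟨rfl, ⟨⟨rfl, rfl, rfl⟩, e⟩, rfl⟩ := e
    obtain rfl := Nat.add_right_cancel e
    rfl
  rw [← hf.encard_image, ← hg.encard_image, ← hh.encard_image,
    ← Set.encard_union_eq, ← Set.encard_union_eq]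
  · congr 1
    ext ⟨A, ⟨t, s⟩, B⟩
    constructor
    · rintro ⟨h1, h2, h3, h4⟩
      cases t with
      | leaf => exact absurd h4 hP
      | node l c r =>
        simp only [leafPath, size] at h1 h2 h3 h4
        split_ifs at h4 with k1 k2
        · refine Or.inl (Or.inl ⟨(A, (l, s), c, r, B), ⟨k1, h2, ?_, h4⟩, rfl⟩)
          simp only [leafCount]
          omega
        · refine Or.inl (Or.inr ⟨((l, A), (c, s - (2 * l.size + 1)), r, B),
            ⟨by dsimp only; omega, ?_, ?_, h4⟩, ?_⟩)
          · simp only [leafCount]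
            omega
          · simp only [leafCount]
            omega
          · simp only [g, Prod.mk.injEq, true_and, and_true]
            omega
        · refine Or.inr ⟨((l, c, A), (r, s - (2 * l.size + 2 * c.size + 2)), B),
            ⟨by dsimp only; omega, ?_, ?_, h4⟩, ?_⟩
          · simp only [leafCount]
            omega
          · dsimp only
            omega
          · simp only [h, Prod.mk.injEq, true_and, and_true]
            omega
    · rintro ((⟨⟨A, ⟨t, s⟩, c, r, B⟩, ⟨h1, h2, h3, h4⟩, e⟩ |
        ⟨⟨⟨l, A⟩, ⟨t, s⟩, r, B⟩, ⟨h1, h2, h3, h4⟩, e⟩) |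
        ⟨⟨⟨l, c, A⟩, ⟨t, s⟩, B⟩, ⟨h1, h2, h3, h4⟩, e⟩) <;> rw [← e] <;>
        simp only [leafCount] at h1 h2 h3 h4
      · refine ⟨?_, h2, ?_, ?_⟩ <;> simp only [f, size, leafPath]
        · omega
        · omega
        · rwa [if_pos h1]
      · refine ⟨?_, ?_, ?_, ?_⟩ <;> simp only [g, size, leafPath]
        · omega
        · omega
        · omega
        · rwa [if_neg (by omega), if_pos (by omega), Nat.add_sub_cancel]
      · refine ⟨?_, ?_, ?_, ?_⟩ <;> simp only [h, size, leafPath]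
        · omega
        · omega
        · omega
        · rwa [if_neg (by omega), if_neg (by omega), Nat.add_sub_cancel]
  · rw [Set.disjoint_left]
    rintro _ (⟨⟨A, ⟨t, s⟩, c, r, B⟩, ⟨h1, -⟩, rfl⟩ | ⟨⟨⟨l, A⟩, ⟨t, s⟩, r, B⟩, ⟨h1, -⟩, rfl⟩)
      ⟨⟨⟨l', c', A'⟩, ⟨t', s'⟩, B'⟩, -, e⟩ <;>
    · simp only [f, g, h, Prod.mk.injEq, node.injEq] at e h1
      obtain ⟨-, ⟨⟨rfl, rfl, rfl⟩, e⟩, -⟩ := e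
      omega
  · rw [Set.disjoint_left]
    rintro _ ⟨⟨A, ⟨t, s⟩, c, r, B⟩, ⟨h1, -⟩, rfl⟩ ⟨⟨⟨l', A'⟩, ⟨t', s'⟩, r', B'⟩, -, e⟩
    simp only [f, g, Prod.mk.injEq, node.injEq] at e h1
    obtain ⟨-, ⟨⟨rfl, rfl, rfl⟩, e⟩, -⟩ := e
    omega

theorem pointed_eq_empty {i j p q : ℕ} {P : ℕ × ℕ × ℕ → Prop} (hP : ∀ m, ¬ P m) :
    pointed i j p q P = ∅ :=
  Set.eq_empty_iff_forall_notMem.2 fun _ hx => hP _ hx.2.2.2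

theorem exists_encard_pointed (m a b c : ℕ) (hm : a + b + c = m) :
    ∃ M : ℕ, M * (a.factorial * b.factorial * c.factorial) = m.factorial ∧
      ∀ i j p q, (pointed i j p q (· = (a, b, c))).encard =
        M * ((forests (i + (2 * c + b)) p).encard * (forests (j + (2 * a + b)) q).encard) := by
  induction m generalizing a b c with
  | zero =>
    obtain ⟨rfl, rfl, rfl⟩ : a = 0 ∧ b = 0 ∧ c = 0 := by omega
    exact ⟨1, rfl, fun i j p q => by simpa using encard_pointed_zero i j p q⟩
  | succ m ih =>
    obtain ⟨M₁, hM₁, h₁⟩ : ∃ M : ℕ,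
        M * (a.factorial * b.factorial * c.factorial) = a * m.factorial ∧
        ∀ i j p q, (pointed i (j + 2) p q fun m => (m.1 + 1, m.2.1, m.2.2) = (a, b, c)).encard =
          M * ((forests (i + (2 * c + b)) p).encard *
            (forests (j + (2 * a + b)) q).encard) := by
      cases a with
      | zero => exact ⟨0, by simp, fun i j p q => by rw [pointed_eq_empty] <;> simp⟩
      | succ a =>
        obtain ⟨M, hM, h⟩ := ih a b c (by omega)
        refine ⟨M, by rw [← hM, Nat.factorial_succ]; ring, fun i j p q => ?_⟩
        rw [show j + (2 * (a + 1) + b) = j + 2 + (2 * a + b) by ring, ← h]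
        congr! 3 with x
        obtain ⟨x, y, z⟩ := x
        simp
    obtain ⟨M₂, hM₂, h₂⟩ : ∃ M : ℕ,
        M * (a.factorial * b.factorial * c.factorial) = b * m.factorial ∧
        ∀ i j p q,
          (pointed (i + 1) (j + 1) p q fun m => (m.1, m.2.1 + 1, m.2.2) = (a, b, c)).encard =
          M * ((forests (i + (2 * c + b)) p).encard *
            (forests (j + (2 * a + b)) q).encard) := by
      cases b with
      | zero => exact ⟨0, by simp, fun i j p q => by rw [pointed_eq_empty] <;> simp⟩
      | succ b =>
        obtain ⟨M, hM, h⟩ := ih a b c (by omega)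
        refine ⟨M, by rw [← hM, Nat.factorial_succ]; ring, fun i j p q => ?_⟩
        rw [show j + (2 * a + (b + 1)) = j + 1 + (2 * a + b) by ring,
          show i + (2 * c + (b + 1)) = i + 1 + (2 * c + b) by ring, ← h]
        congr! 3 with x
        obtain ⟨x, y, z⟩ := x
        simp
    obtain ⟨M₃, hM₃, h₃⟩ : ∃ M : ℕ,
        M * (a.factorial * b.factorial * c.factorial) = c * m.factorial ∧
        ∀ i j p q, (pointed (i + 2) j p q fun m => (m.1, m.2.1, m.2.2 + 1) = (a, b, c)).encard =
          M * ((forests (i + (2 * c + b)) p).encard *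
            (forests (j + (2 * a + b)) q).encard) := by
      cases c with
      | zero => exact ⟨0, by simp, fun i j p q => by rw [pointed_eq_empty] <;> simp⟩
      | succ c =>
        obtain ⟨M, hM, h⟩ := ih a b c (by omega)
        refine ⟨M, by rw [← hM, Nat.factorial_succ]; ring, fun i j p q => ?_⟩
        rw [show i + (2 * (c + 1) + b) = i + 2 + (2 * c + b) by ring, ← h]
        congr! 3 with x
        obtain ⟨x, y, z⟩ := x
        simp
    refine ⟨M₁ + M₂ + M₃, ?_, fun i j p q => ?_⟩
    · rw [add_mul, add_mul, hM₁, hM₂, hM₃, ← add_mul, ← add_mul, hm, Nat.factorial_succ]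
    · rw [encard_pointed _ _ _ _ _ (by simp only [Prod.mk.injEq]; omega), h₁, h₂, h₃]
      push_cast
      rw [add_mul, add_mul]

end TernaryTree

open TernaryTree

theorem exists_pathCount_eq (n s m₁ m₂ m₃ : ℕ) (hs : s ≤ 2 * n) :
    ∃ M : ℕ, M * (m₁.factorial * m₂.factorial * m₃.factorial) = (m₁ + m₂ + m₃).factorial ∧
      pathCount n s m₁ m₂ m₃ = M * ((forests (2 * m₃ + m₂) s).ncard *
        (forests (2 * m₁ + m₂) (2 * n - s)).ncard) := by
  obtain ⟨M, hM, h⟩ := exists_encard_pointed _ m₁ m₂ m₃ rfl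
  refine ⟨M, hM, ?_⟩
  let f : TernaryTree → Forest 0 × (TernaryTree × ℕ) × Forest 0 := fun t => ((), (t, s), ())
  have hf : f.Injective := fun t u e => by simpa [f] using e
  have e : pointed 0 0 s (2 * n - s) (· = (m₁, m₂, m₃)) =
      f '' {t | t.size = n ∧ t.leafPath s = (m₁, m₂, m₃)} := by
    ext ⟨⟨⟩, ⟨t, s'⟩, ⟨⟩⟩
    constructor
    · rintro ⟨h1, h2, h3, h4⟩
      simp only [leafCount, zero_add] at h1 h2 h3 h4
      subst h2
      exact ⟨t, ⟨by omega, h4⟩, rfl⟩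
    · rintro ⟨t', ⟨h1, h2⟩, e⟩
      simp only [f, Prod.mk.injEq, true_and, and_true] at e
      obtain ⟨rfl, rfl⟩ := e
      refine ⟨?_, ?_, ?_, h2⟩ <;> simp only [leafCount] <;> omega
  have h' := h 0 0 s (2 * n - s)
  rw [e, hf.encard_image, zero_add, zero_add] at h'
  have h'' := congrArg ENat.toNat h'
  rwa [ENat.toNat_mul, ENat.toNat_mul, ENat.toNat_natCast] at h''

theorem ncard_forests_eq_zero {k p : ℕ} (h : ∀ N, p ≠ 2 * N + k) : (forests k p).ncard = 0 := by
  simp [Set.ncard, encard_forests_eq_zero h]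

theorem ncard_forests_zero_zero : (forests 0 0).ncard = 1 := by
  rw [Set.ncard, encard_forests_zero_zero, ENat.toNat_one]

theorem ncard_forests (N k : ℕ) (hk : 3 * N + k ≠ 0) :
    ((forests k (2 * N + k)).ncard : ℚ) = k * (3 * N + k).choose N / (3 * N + k) := by
  obtain ⟨c, hc, h⟩ := exists_encard_forests N k
  have hc' : (forests k (2 * N + k)).ncard = c := by simp [Set.ncard, hc]
  have h2 := Nat.choose_mul_factorial_mul_factorial (show N ≤ 3 * N + k by omega)
  rw [show 3 * N + k - N = 2 * N + k by omega] at h2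
  have hk' : (3 * N + k : ℚ) ≠ 0 := by exact_mod_cast hk
  rw [hc', eq_div_iff hk']
  have hpos : N.factorial * (2 * N + k).factorial ≠ 0 := by positivity
  have : c * (3 * N + k) = k * (3 * N + k).choose N := by
    apply Nat.eq_of_mul_eq_mul_right (Nat.pos_of_ne_zero hpos)
    linear_combination h - k * h2
  exact_mod_cast this

theorem ichoose_natCast (a b : ℕ) : ichoose a b = a.choose b := by
  by_cases h : b ≤ a
  · simp [ichoose, h]
  · simp [ichoose, h, Nat.choose_eq_zero_of_lt (not_le.1 h)]

theorem ichoose_of_neg (a : ℤ) {b : ℤ} (hb : b < 0) : ichoose a b = 0 :=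
  if_neg fun h => hb.not_ge h.1

/-- the explicit formulas for `T_{n,s,m₁,m₂,m₃}`, with
`s = 2 s₁ + s₂`, `0 ≤ s₁ ≤ n`, `s₂ ∈ {0, 1}` (and `s ≤ 2n`):
(i) the generic case; (ii) the case `(m₂, m₃) = (0, 0)`, `s = 0`, `m₁ ≤ n`;
(iii) the case `(m₁, m₂) = (0, 0)`, `s = 2n`, `m₃ ≤ n`; (iv) all other cases give `0`. -/
theorem stmt_15 (n s s₁ s₂ m₁ m₂ m₃ : ℕ) (hn : 1 ≤ n)
    (hs : s = 2 * s₁ + s₂) (hs₁ : s₁ ≤ n) (hs₂ : s₂ ≤ 1) (hsn : s ≤ 2 * n) :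
    (∀ μ₂ : ℕ, m₃ ≤ s₁ → m₂ = s₂ + 2 * μ₂ → m₃ + μ₂ ≤ s₁ →
      ¬(m₁ = 0 ∧ m₂ = 0) → ¬(m₃ = 0 ∧ m₂ = 0) →
      (pathCount n s m₁ m₂ m₃ : ℚ) =
        (2 * (m₃ : ℚ) + m₂) * (2 * (m₁ : ℚ) + m₂) *
          (((m₁ + m₂ + m₃).factorial : ℚ) /
            ((m₁.factorial : ℚ) * (m₂.factorial : ℚ) * (m₃.factorial : ℚ))) *
          ichoose (3 * (s₁ : ℤ) + s₂ - m₃ - μ₂) ((s₁ : ℤ) - m₃ - μ₂) *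
          ichoose (3 * (n : ℤ) - m₁ - 2 * m₂ - 3 * s₁ + 3 * μ₂)
            ((n : ℤ) - m₁ - m₂ - s₁ + μ₂) /
          ((3 * (s₁ : ℚ) + s₂ - m₃ - μ₂) *
            (3 * (n : ℚ) - m₁ - 2 * m₂ - 3 * s₁ + 3 * μ₂))) ∧
    (m₂ = 0 → m₃ = 0 → s = 0 → m₁ ≤ n →
      (pathCount n s m₁ m₂ m₃ : ℚ) =
        2 * (m₁ : ℚ) / (3 * (n : ℚ) - m₁) * ((3 * n - m₁).choose (2 * n) : ℚ)) ∧
    (m₁ = 0 → m₂ = 0 → s = 2 * n → m₃ ≤ n →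
      (pathCount n s m₁ m₂ m₃ : ℚ) =
        2 * (m₃ : ℚ) / (3 * (n : ℚ) - m₃) * ((3 * n - m₃).choose (2 * n) : ℚ)) ∧
    (¬(∃ μ₂ : ℕ, m₃ ≤ s₁ ∧ m₂ = s₂ + 2 * μ₂ ∧ m₃ + μ₂ ≤ s₁ ∧
          ¬(m₁ = 0 ∧ m₂ = 0) ∧ ¬(m₃ = 0 ∧ m₂ = 0)) →
      ¬(m₂ = 0 ∧ m₃ = 0 ∧ s = 0 ∧ m₁ ≤ n) →
      ¬(m₁ = 0 ∧ m₂ = 0 ∧ s = 2 * n ∧ m₃ ≤ n) →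
      pathCount n s m₁ m₂ m₃ = 0) := by
  obtain ⟨M, hM, hP⟩ := exists_pathCount_eq n s m₁ m₂ m₃ hsn
  rw [hP]
  refine ⟨?_, ?_, ?_, ?_⟩
  · intro μ₂ h1 h2 h3 h4 h5
    have hM' : (((m₁ + m₂ + m₃).factorial : ℚ) /
        ((m₁.factorial : ℚ) * (m₂.factorial : ℚ) * (m₃.factorial : ℚ))) = M := by
      rw [div_eq_iff (by positivity), ← hM]
      push_cast
      ring
    obtain ⟨N, rfl⟩ : ∃ N, s₁ = m₃ + μ₂ + N := Nat.exists_eq_add_of_le h3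
    have hL := ncard_forests N (2 * m₃ + m₂) (by omega)
    rw [show 2 * N + (2 * m₃ + m₂) = s by omega] at hL
    rw [hM', show 3 * ((m₃ + μ₂ + N : ℕ) : ℤ) + s₂ - m₃ - μ₂ = (3 * N + (2 * m₃ + m₂) : ℕ) by
        subst h2; push_cast; ring,
      show ((m₃ + μ₂ + N : ℕ) : ℤ) - m₃ - μ₂ = N by push_cast; ring, ichoose_natCast,
      show 3 * ((m₃ + μ₂ + N : ℕ) : ℚ) + s₂ - m₃ - μ₂ = 3 * N + (2 * m₃ + m₂ : ℕ) by
        subst h2; push_cast; ring]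
    by_cases hR : m₁ + s₂ + 2 * μ₂ + m₃ + N ≤ n
    · obtain ⟨K, hK⟩ := Nat.exists_eq_add_of_le hR
      have hR := ncard_forests K (2 * m₁ + m₂) (by omega)
      rw [show 2 * K + (2 * m₁ + m₂) = 2 * n - s by omega] at hR
      rw [show 3 * (n : ℤ) - m₁ - 2 * m₂ - 3 * (m₃ + μ₂ + N : ℕ) + 3 * μ₂ =
          (3 * K + (2 * m₁ + m₂) : ℕ) by subst hK h2; push_cast; ring,
        show (n : ℤ) - m₁ - m₂ - (m₃ + μ₂ + N : ℕ) + μ₂ = K by subst hK h2; push_cast; ring,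
        ichoose_natCast,
        show 3 * (n : ℚ) - m₁ - 2 * m₂ - 3 * (m₃ + μ₂ + N : ℕ) + 3 * μ₂ =
          3 * K + (2 * m₁ + m₂ : ℕ) by subst hK h2; push_cast; ring]
      push_cast at hL hR ⊢
      rw [hL, hR, div_mul_div_comm, mul_div_assoc']
      ring
    · rw [ichoose_of_neg _ (by omega), ncard_forests_eq_zero (k := 2 * m₁ + m₂) fun K => by omega]
      simp
  · rintro rfl rfl rfl hle
    obtain ⟨K, rfl⟩ := Nat.exists_eq_add_of_le hle
    have hM1 : M = 1 := by
      simpa [Nat.factorial_ne_zero] using hM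
    have hR := ncard_forests K (2 * m₁) (by omega)
    rw [hM1, mul_zero, add_zero, add_zero, ncard_forests_zero_zero, one_mul, one_mul,
      show 2 * (m₁ + K) - 0 = 2 * K + 2 * m₁ by omega, hR,
      Nat.choose_symm_of_eq_add (show 3 * K + 2 * m₁ = K + (2 * (m₁ + K)) by ring),
      show 3 * (m₁ + K) - m₁ = 3 * K + 2 * m₁ by omega]
    push_cast
    rw [show 3 * ((m₁ : ℚ) + K) - m₁ = 3 * K + 2 * m₁ by ring]
    ring
  · rintro rfl rfl h hle
    obtain ⟨K, rfl⟩ := Nat.exists_eq_add_of_le hle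
    have hM1 : M = 1 := by
      simpa [Nat.factorial_ne_zero] using hM
    have hR := ncard_forests K (2 * m₃) (by omega)
    rw [hM1, mul_zero, add_zero, add_zero, h, Nat.sub_self, ncard_forests_zero_zero, mul_one,
      one_mul, show 2 * (m₃ + K) = 2 * K + 2 * m₃ by omega, hR,
      Nat.choose_symm_of_eq_add (show 3 * K + 2 * m₃ = K + (2 * K + 2 * m₃) by ring),
      show 3 * (m₃ + K) - m₃ = 3 * K + 2 * m₃ by omega]
    push_cast
    rw [show 3 * ((m₃ : ℚ) + K) - m₃ = 3 * K + 2 * m₃ by ring]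
    ring
  · intro h1 h2 h3
    by_cases hL : ∃ N, s = 2 * N + (2 * m₃ + m₂)
    · by_cases hR : ∃ K, 2 * n - s = 2 * K + (2 * m₁ + m₂)
      · obtain ⟨N, hN⟩ := hL
        obtain ⟨K, hK⟩ := hR
        have hempty (J : ℕ) (hJ : J ≠ 0) : (forests 0 (2 * J + 0)).ncard = 0 := by
          simpa using ncard_forests J 0 (by omega)
        by_cases hA : m₁ = 0 ∧ m₂ = 0
        · obtain ⟨rfl, rfl⟩ := hA
          rw [hK, mul_zero 2, add_zero 0, hempty K (by omega), mul_zero, mul_zero]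
        by_cases hB : m₃ = 0 ∧ m₂ = 0
        · obtain ⟨rfl, rfl⟩ := hB
          rw [hN, mul_zero 2, add_zero 0, hempty N (by omega), zero_mul, mul_zero]
        exact absurd ⟨(m₂ - s₂) / 2, by omega, by omega, by omega, hA, hB⟩ h1
      · rw [ncard_forests_eq_zero (k := 2 * m₁ + m₂) (not_exists.1 hR), mul_zero, mul_zero]
    · rw [ncard_forests_eq_zero (not_exists.1 hL), zero_mul, mul_zero]
end

section
/- In the field of rational functions ℚ(X, y) in two indeterminates X and y, set T := (1+X+X²)/(1+X²). Then the following identity holds: T·(1−yX)²·(1−yX²)·(1−yX³)·(1−yX⁴)² = (1−yX)·(1−yX²)²·(1−yX³)²·(1−yX⁴) + (T−1)·(1−y)·(1−yX)·(1−yX²)·(1−yX³)·(1−yX⁴)·(1−yX⁵). Consequently, with v_j := 1 − λX^{j+1} and z·T³ = T − 1, the family T_j = T·v_{j+1}v_{j+4}/(v_{j+2}v_{j+3}) satisfies T_j = 1 + z·T_{j−1}T_jT_{j+1} for all j ∈ ℤ. -/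
/-- The field of rational functions `ℚ(X, y)` in two indeterminates. -/
noncomputable abbrev RatFuncField2 : Type := FractionRing (MvPolynomial (Fin 2) ℚ)

/-- The indeterminate `X`, viewed inside `ℚ(X, y)`. -/
noncomputable def Xvar : RatFuncField2 :=
  algebraMap (MvPolynomial (Fin 2) ℚ) RatFuncField2 (MvPolynomial.X 0)

/-- The indeterminate `y`, viewed inside `ℚ(X, y)`. -/
noncomputable def yvar : RatFuncField2 :=
  algebraMap (MvPolynomial (Fin 2) ℚ) RatFuncField2 (MvPolynomial.X 1)

/-- `T = (1 + X + X²)/(1 + X²)` in `ℚ(X, y)`. -/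
noncomputable def Tval : RatFuncField2 := (1 + Xvar + Xvar ^ 2) / (1 + Xvar ^ 2)

theorem Xvar_ne_zero : Xvar ≠ 0 := by
  simp [Xvar]

theorem one_add_Xvar_sq_ne_zero : (1 + Xvar ^ 2 : RatFuncField2) ≠ 0 := by
  have hp : (1 + MvPolynomial.X 0 ^ 2 : MvPolynomial (Fin 2) ℚ) ≠ 0 := fun h => by
    simpa using congrArg (MvPolynomial.eval 0) h
  have hmap := (map_ne_zero_iff (algebraMap (MvPolynomial (Fin 2) ℚ) RatFuncField2)
    (IsFractionRing.injective _ _)).2 hp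
  simpa [Xvar] using hmap

/-- The quadratic relation from which the identity of the main theorem follows by multiplication
with `(1 - yX)(1 - yX²)(1 - yX³)(1 - yX⁴)`. -/
theorem Tval_quadratic_relation (y : RatFuncField2) :
    Tval * ((1 - y * Xvar) * (1 - y * Xvar ^ 4)) =
      (1 - y * Xvar ^ 2) * (1 - y * Xvar ^ 3) +
        (Tval - 1) * ((1 - y) * (1 - y * Xvar ^ 5)) := by
  have h := one_add_Xvar_sq_ne_zero
  rw [Tval]
  field_simp
  ring

/-- in `ℚ(X, y)`, with `T = (1+X+X²)/(1+X²)`,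
`T (1-yX)² (1-yX²) (1-yX³) (1-yX⁴)²
  = (1-yX)(1-yX²)²(1-yX³)²(1-yX⁴) + (T-1)(1-y)(1-yX)(1-yX²)(1-yX³)(1-yX⁴)(1-yX⁵)`;
consequently, with `v_j = 1 - λ X^{j+1}` and `z T³ = T - 1`, the family
`T_j = T v_{j+1} v_{j+4} / (v_{j+2} v_{j+3})` satisfies
`T_j = 1 + z T_{j-1} T_j T_{j+1}` for all `j ∈ ℤ`, i.e.
`T v²_{j+1} v_{j+2} v_{j+3} v²_{j+4}
  = v_{j+1} v²_{j+2} v²_{j+3} v_{j+4} + z T³ v_j v_{j+1} v_{j+2} v_{j+3} v_{j+4} v_{j+5}`. -/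
theorem stmt_19 :
    Tval * (1 - yvar * Xvar) ^ 2 * (1 - yvar * Xvar ^ 2) * (1 - yvar * Xvar ^ 3) *
        (1 - yvar * Xvar ^ 4) ^ 2 =
      (1 - yvar * Xvar) * (1 - yvar * Xvar ^ 2) ^ 2 * (1 - yvar * Xvar ^ 3) ^ 2 *
          (1 - yvar * Xvar ^ 4) +
        (Tval - 1) * (1 - yvar) * (1 - yvar * Xvar) * (1 - yvar * Xvar ^ 2) *
          (1 - yvar * Xvar ^ 3) * (1 - yvar * Xvar ^ 4) * (1 - yvar * Xvar ^ 5) ∧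
    ∀ (lam z : RatFuncField2), z * Tval ^ 3 = Tval - 1 →
      ∀ j : ℤ,
        Tval * (1 - lam * Xvar ^ (j + 2)) ^ 2 * (1 - lam * Xvar ^ (j + 3)) *
            (1 - lam * Xvar ^ (j + 4)) * (1 - lam * Xvar ^ (j + 5)) ^ 2 =
          (1 - lam * Xvar ^ (j + 2)) * (1 - lam * Xvar ^ (j + 3)) ^ 2 *
              (1 - lam * Xvar ^ (j + 4)) ^ 2 * (1 - lam * Xvar ^ (j + 5)) +
            z * Tval ^ 3 * ((1 - lam * Xvar ^ (j + 1)) * (1 - lam * Xvar ^ (j + 2)) *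
              (1 - lam * Xvar ^ (j + 3)) * (1 - lam * Xvar ^ (j + 4)) *
              (1 - lam * Xvar ^ (j + 5)) * (1 - lam * Xvar ^ (j + 6))) := by
  refine ⟨?_, fun lam z hz j => ?_⟩
  · linear_combination (1 - yvar * Xvar) * (1 - yvar * Xvar ^ 2) * (1 - yvar * Xvar ^ 3) *
      (1 - yvar * Xvar ^ 4) * Tval_quadratic_relation yvar
  · have hpow (n : ℕ) : Xvar ^ (j + 1 + n) = Xvar ^ (j + 1) * Xvar ^ n := by
      rw [zpow_add₀ Xvar_ne_zero, zpow_natCast]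
    have h2 : Xvar ^ (j + 2) = Xvar ^ (j + 1) * Xvar := by simpa [add_assoc] using hpow 1
    have h3 : Xvar ^ (j + 3) = Xvar ^ (j + 1) * Xvar ^ 2 := by simpa [add_assoc] using hpow 2
    have h4 : Xvar ^ (j + 4) = Xvar ^ (j + 1) * Xvar ^ 3 := by simpa [add_assoc] using hpow 3
    have h5 : Xvar ^ (j + 5) = Xvar ^ (j + 1) * Xvar ^ 4 := by simpa [add_assoc] using hpow 4
    have h6 : Xvar ^ (j + 6) = Xvar ^ (j + 1) * Xvar ^ 5 := by simpa [add_assoc] using hpow 5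
    rw [hz, h2, h3, h4, h5, h6]
    generalize Xvar ^ (j + 1) = w
    linear_combination (1 - lam * w * Xvar) * (1 - lam * w * Xvar ^ 2) *
      (1 - lam * w * Xvar ^ 3) * (1 - lam * w * Xvar ^ 4) * Tval_quadratic_relation (lam * w)
end
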